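/- Let f : ℝ³ → ℝ be a smooth harmonic function (Δf = 0 on ℝ³). If there exist s ≥ 1 and 0 ≤ δ < 3 such that ∫_{ℝ³} |f(x)|^s (1+|x|)^{−δ} dx < +∞, then f ≡ 0. -/

import Mathlib

open MeasureTheory Filter Metric Real

noncomputable section

/-- Three-dimensional Euclidean space. -/
abbrev E3 : Type := EuclideanSpace ℝ (Fin 3)

/-- Partial derivative `∂_j f` of a scalar field. -/
def pd (j : Fin 3) (f : E3 → ℝ) (x : E3) : ℝ :=
  fderiv ℝ f x (EuclideanSpace.single j 1)

/-- Laplacian of a scalar field. -/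
def lap (f : E3 → ℝ) (x : E3) : ℝ := ∑ j, pd j (pd j f) x

/-- `|∇v|² = Σ_{i,k} (∂_i v_k)²`. -/
def gradSq (v : E3 → Fin 3 → ℝ) (x : E3) : ℝ :=
  ∑ i, ∑ k, (pd i (fun y => v y k) x) ^ 2

/-- The radial bump `(1 - |y|²)₊` supported in the closed unit ball. -/
def bump (y : E3) : ℝ := max (1 - ‖y‖ ^ 2) 0

lemma bump_nonneg (y : E3) : 0 ≤ bump y := le_max_right _ _

lemma bump_le_one (y : E3) : bump y ≤ 1 :=
  max_le (by nlinarith [sq_nonneg ‖y‖]) zero_le_one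

lemma bump_eq_zero {y : E3} (hy : 1 < ‖y‖) : bump y = 0 :=
  max_eq_right (by nlinarith)

lemma continuous_bump : Continuous bump := by
  unfold bump
  fun_prop

lemma hasCompactSupport_bump : HasCompactSupport bump :=
  HasCompactSupport.intro (isCompact_closedBall (0 : E3) 1) fun y hy =>
    bump_eq_zero (by simpa using hy)

lemma integral_bump_pos : 0 < ∫ y, bump y :=
  continuous_bump.integral_pos_of_hasCompactSupport_nonneg_nonzero hasCompactSupport_bump
    bump_nonneg (x := 0) (by simp [bump])

/-- A continuous function times the bump is integrable. -/
lemma integrable_mul_bump {g : E3 → ℝ} (hg : Continuous g) :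
    Integrable fun y => g y * bump y :=
  (hg.mul continuous_bump).integrable_of_hasCompactSupport hasCompactSupport_bump.mul_left

lemma hasDerivAt_max_zero_sq (t : ℝ) :
    HasDerivAt (fun u : ℝ => (max u 0) ^ 2) (2 * max t 0) t := by
  rcases lt_trichotomy t 0 with ht | rfl | ht
  · rw [max_eq_right ht.le, mul_zero]
    refine (hasDerivAt_const t (0 : ℝ)).congr_of_eventuallyEq ?_
    filter_upwards [Iio_mem_nhds ht] with u hu
    simp [max_eq_right (Set.mem_Iio.1 hu).le]
  · have h : (fun u : ℝ => (max u 0) ^ 2) =O[nhds 0] fun u => ‖u - 0‖ ^ 2 := by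
      refine Asymptotics.IsBigO.of_bound 1 (Eventually.of_forall fun u => ?_)
      rcases le_total u 0 with hu | hu <;> simp [hu, sq_nonneg]
    simpa using (h.hasFDerivAt (𝕜 := ℝ) one_lt_two).hasDerivAt
  · rw [max_eq_left ht.le]
    refine HasDerivAt.congr_of_eventuallyEq (f := fun u : ℝ => u ^ 2)
      (by simpa using hasDerivAt_pow 2 t) ?_
    filter_upwards [Ioi_mem_nhds ht] with u hu
    simp [max_eq_left (Set.mem_Ioi.1 hu).le]

lemma hasFDerivAt_bump_sq (y : E3) :
    HasFDerivAt (fun z => bump z ^ 2)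
      ((2 * bump y) • (-(2 • innerSL ℝ y : E3 →L[ℝ] ℝ))) y := by
  have h : HasFDerivAt (fun z : E3 => 1 - ‖z‖ ^ 2) (-(2 • innerSL ℝ y : E3 →L[ℝ] ℝ)) y :=
    ((hasStrictFDerivAt_norm_sq y).hasFDerivAt).const_sub 1
  exact (hasDerivAt_max_zero_sq (1 - ‖y‖ ^ 2)).comp_hasFDerivAt y h

lemma fderiv_bump_sq_single (y : E3) (j : Fin 3) :
    fderiv ℝ (fun z => bump z ^ 2) y (EuclideanSpace.single j 1) = -4 * (y j * bump y) := by
  rw [(hasFDerivAt_bump_sq y).fderiv]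
  simp [EuclideanSpace.inner_single_right]
  ring

lemma contDiff_pd {f : E3 → ℝ} (hf : ContDiff ℝ (⊤ : ℕ∞) f) (j : Fin 3) :
    ContDiff ℝ (⊤ : ℕ∞) (pd j f) :=
  (hf.fderiv_right (m := (⊤ : ℕ∞)) (by simp)).clm_apply contDiff_const

lemma fderiv_eq_sum_pd (f : E3 → ℝ) (x v : E3) :
    fderiv ℝ f x v = ∑ j, v j * pd j f x := by
  conv_lhs => rw [← (EuclideanSpace.basisFun (Fin 3) ℝ).sum_repr v]
  simp [pd]

lemma integral_pd_mul_coord_mul_bump {f : E3 → ℝ} (hf : ContDiff ℝ (⊤ : ℕ∞) f) (x : E3) (r : ℝ)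
    (j : Fin 3) :
    ∫ y, pd j f (x + r • y) * (y j * bump y) =
      r / 4 * ∫ y, pd j (pd j f) (x + r • y) * bump y ^ 2 := by
  have hg := contDiff_pd hf j
  have hgg := contDiff_pd hg j
  have hd (y : E3) : HasFDerivAt (fun z => pd j f (x + r • z))
      ((fderiv ℝ (pd j f) (x + r • y)).comp (r • ContinuousLinearMap.id ℝ E3)) y :=
    (hg.differentiable (by simp) _).hasFDerivAt.comp y
      (((hasFDerivAt_id y).const_smul r).const_add x)
  have hpd (y : E3) : fderiv ℝ (fun z => pd j f (x + r • z)) y (EuclideanSpace.single j 1) =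
      r * pd j (pd j f) (x + r • y) := by
    rw [(hd y).fderiv]
    simp [pd]
  have hc := hg.continuous
  have hcc := hgg.continuous
  have hb := continuous_bump
  have key := integral_mul_fderiv_eq_neg_fderiv_mul_of_integrable (μ := (volume : Measure E3))
    (f := fun z => pd j f (x + r • z)) (g := fun z => bump z ^ 2)
    (v := EuclideanSpace.single j 1)
    (by
      simp only [hpd, pow_two, ← mul_assoc]
      exact integrable_mul_bump (by fun_prop))
    (by
      simp only [fderiv_bump_sq_single, ← mul_assoc]
      exact integrable_mul_bump (by fun_prop))
    (by
      simp only [pow_two, ← mul_assoc]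
      exact integrable_mul_bump (by fun_prop))
    (fun y _ => (hd y).differentiableAt)
    (fun y _ => (hasFDerivAt_bump_sq y).differentiableAt)
  simp only [hpd, fderiv_bump_sq_single, mul_left_comm _ (-4 : ℝ), mul_assoc,
    integral_const_mul] at key
  linarith

lemma integral_fderiv_mul_bump_eq_zero {f : E3 → ℝ} (hf : ContDiff ℝ (⊤ : ℕ∞) f)
    (hharm : ∀ x : E3, lap f x = 0) (x : E3) (r : ℝ) :
    ∫ y, fderiv ℝ f (x + r • y) y * bump y = 0 := by
  have hb := continuous_bump
  have hc (j : Fin 3) := (contDiff_pd hf j).continuous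
  have hcc (j : Fin 3) := (contDiff_pd (contDiff_pd hf j) j).continuous
  have h1 (j : Fin 3) : Integrable fun y : E3 => pd j f (x + r • y) * (y j * bump y) := by
    simp only [← mul_assoc]
    have := hc j
    exact integrable_mul_bump (by fun_prop)
  have h2 (j : Fin 3) : Integrable fun y : E3 => pd j (pd j f) (x + r • y) * bump y ^ 2 := by
    simp only [pow_two, ← mul_assoc]
    have := hcc j
    exact integrable_mul_bump (by fun_prop)
  calc ∫ y, fderiv ℝ f (x + r • y) y * bump y
      = ∫ y : E3, ∑ j, pd j f (x + r • y) * (y j * bump y) := by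
        congr 1 with y
        rw [fderiv_eq_sum_pd, Finset.sum_mul]
        exact Finset.sum_congr rfl fun j _ => by ring
    _ = ∑ j, r / 4 * ∫ y, pd j (pd j f) (x + r • y) * bump y ^ 2 := by
        rw [integral_finsetSum _ fun j _ => h1 j]
        exact Finset.sum_congr rfl fun j _ => integral_pd_mul_coord_mul_bump hf x r j
    _ = r / 4 * ∫ y, lap f (x + r • y) * bump y ^ 2 := by
        rw [← Finset.mul_sum, ← integral_finsetSum _ fun j _ => h2 j]
        simp only [lap, Finset.sum_mul]
    _ = 0 := by simp [hharm]

lemma hasDerivAt_integral_comp_mul_bump {f : E3 → ℝ} (hf : ContDiff ℝ (⊤ : ℕ∞) f)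
    (x : E3) (r : ℝ) :
    HasDerivAt (fun t : ℝ => ∫ y, f (x + t • y) * bump y)
      (∫ y, fderiv ℝ f (x + r • y) y * bump y) r := by
  have hc := hf.continuous
  have hc' : Continuous (fderiv ℝ f) := hf.continuous_fderiv (by simp)
  obtain ⟨M, hM⟩ := (isCompact_closedBall x (|r| + 1)).exists_bound_of_continuousOn
    hc'.continuousOn
  have hM0 : 0 ≤ M := (norm_nonneg _).trans (hM x (mem_closedBall_self (by positivity)))
  refine (hasDerivAt_integral_of_dominated_loc_of_deriv_le (bound := fun y => M * bump y)
    (F' := fun t y => fderiv ℝ f (x + t • y) y * bump y)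
    (ball_mem_nhds r one_pos) ?_ ?_ ?_ ?_ ?_ ?_).2
  · exact Eventually.of_forall fun t =>
      (integrable_mul_bump (g := fun y => f (x + t • y)) (by fun_prop)).aestronglyMeasurable
  · exact integrable_mul_bump (by fun_prop)
  · exact (integrable_mul_bump (g := fun y => fderiv ℝ f (x + r • y) y)
      (by fun_prop)).aestronglyMeasurable
  · refine Eventually.of_forall fun y t ht => ?_
    rw [norm_mul, Real.norm_of_nonneg (bump_nonneg y)]
    rcases lt_or_ge 1 ‖y‖ with hy | hy
    · simp [bump_eq_zero hy]
    · refine mul_le_mul_of_nonneg_right ?_ (bump_nonneg y)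
      have ht' : |t| ≤ |r| + 1 := by
        have := abs_sub_abs_le_abs_sub t r
        rw [mem_ball, Real.dist_eq] at ht
        linarith
      have hmem : x + t • y ∈ closedBall x (|r| + 1) := by
        rw [mem_closedBall, dist_eq_norm, add_sub_cancel_left, norm_smul, Real.norm_eq_abs]
        nlinarith [norm_nonneg y, abs_nonneg t]
      calc ‖fderiv ℝ f (x + t • y) y‖ ≤ ‖fderiv ℝ f (x + t • y)‖ * ‖y‖ :=
            ContinuousLinearMap.le_opNorm _ _
        _ ≤ M * 1 := mul_le_mul (hM _ hmem) hy (norm_nonneg _) hM0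
        _ = M := mul_one M
  · exact integrable_mul_bump continuous_const
  · refine Eventually.of_forall fun y t _ => HasDerivAt.mul_const ?_ _
    have hl : HasDerivAt (fun t : ℝ => x + t • y) y t := by
      simpa using ((hasDerivAt_id t).smul_const y).const_add x
    exact (hf.differentiable (by simp) _).hasFDerivAt.comp_hasDerivAt t hl

/-- Mean value property of harmonic functions, averaged against the bump. -/
lemma integral_comp_mul_bump {f : E3 → ℝ} (hf : ContDiff ℝ (⊤ : ℕ∞) f)
    (hharm : ∀ x : E3, lap f x = 0) (x : E3) (r : ℝ) :
    ∫ y, f (x + r • y) * bump y = f x * ∫ y, bump y := by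
  have h (t : ℝ) := hasDerivAt_integral_comp_mul_bump hf x t
  have := is_const_of_deriv_eq_zero (fun t => (h t).differentiableAt)
    (fun t => (h t).deriv.trans (integral_fderiv_mul_bump_eq_zero hf hharm x t)) r 0
  rw [this]
  simp [integral_const_mul]

lemma integral_abs_rpow_mul_bump_le {f : E3 → ℝ} (hf : Continuous f) {s δ : ℝ} (hs : 0 ≤ s)
    (hδ : 0 ≤ δ) (hint : Integrable (fun x : E3 => |f x| ^ s * (1 + ‖x‖) ^ (-δ)))
    (x : E3) {r : ℝ} (hr : 1 + ‖x‖ ≤ r) :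
    ∫ y, |f (x + r • y)| ^ s * bump y ≤
      2 ^ δ * (∫ z, |f z| ^ s * (1 + ‖z‖) ^ (-δ)) * r ^ (-(3 - δ)) := by
  have hr0 : 0 < r := by linarith [norm_nonneg x]
  set w : E3 → ℝ := fun z => |f z| ^ s * (1 + ‖z‖) ^ (-δ) with hw
  have hpt (y : E3) : |f (x + r • y)| ^ s * bump y ≤ (2 * r) ^ δ * w (x + r • y) := by
    rcases lt_or_ge 1 ‖y‖ with hy | hy
    · rw [bump_eq_zero hy, mul_zero]
      positivity
    · set z := x + r • y
      have hzn : 1 + ‖z‖ ≤ 2 * r := by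
        have h1 : ‖z‖ ≤ ‖x‖ + ‖r • y‖ := norm_add_le _ _
        rw [norm_smul, Real.norm_of_nonneg hr0.le] at h1
        nlinarith
      have h1 : 1 ≤ (2 * r) ^ δ * (1 + ‖z‖) ^ (-δ) := by
        rw [Real.rpow_neg (by positivity), ← div_eq_mul_inv, one_le_div (by positivity)]
        exact Real.rpow_le_rpow (by positivity) hzn hδ
      calc |f z| ^ s * bump y ≤ |f z| ^ s * ((2 * r) ^ δ * (1 + ‖z‖) ^ (-δ)) := by
            gcongr
            exact (bump_le_one y).trans h1
        _ = (2 * r) ^ δ * w z := by rw [hw]; ring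
  have hwi : Integrable fun y : E3 => w (x + r • y) :=
    (hint.comp_add_left x).comp_smul hr0.ne'
  have hwe : ∫ y : E3, w (x + r • y) = (r ^ 3)⁻¹ * ∫ z, w z := by
    rw [Measure.integral_comp_smul volume (fun z => w (x + z)) r, integral_add_left_eq_self w x]
    simp [abs_of_pos hr0]
  calc ∫ y, |f (x + r • y)| ^ s * bump y ≤ ∫ y, (2 * r) ^ δ * w (x + r • y) := by
        refine integral_mono (integrable_mul_bump ?_) (hwi.const_mul _) hpt
        exact Continuous.rpow_const (by fun_prop) fun _ => Or.inr hs
    _ = 2 ^ δ * (∫ z, w z) * r ^ (-(3 - δ)) := by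
        rw [integral_const_mul, hwe, Real.mul_rpow zero_le_two hr0.le, neg_sub,
          Real.rpow_sub hr0, ← Real.rpow_natCast r 3]
        push_cast
        ring

lemma le_add_rpow_mul {s t ε : ℝ} (hs : 1 ≤ s) (ht : 0 ≤ t) (hε : 0 < ε) :
    t ≤ ε + ε ^ (1 - s) * t ^ s := by
  rcases le_or_gt t ε with h | h
  · have : 0 ≤ ε ^ (1 - s) * t ^ s := by positivity
    linarith
  · have ht0 : 0 < t := hε.trans h
    calc t = t ^ (1 - s) * t ^ s := by rw [← Real.rpow_add ht0]; simp
      _ ≤ ε ^ (1 - s) * t ^ s :=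
        mul_le_mul_of_nonneg_right (Real.rpow_le_rpow_of_nonpos hε h.le (sub_nonpos.2 hs))
          (by positivity)
      _ ≤ ε + ε ^ (1 - s) * t ^ s := by linarith

theorem harmonic_weighted_integrable_eq_zero
    (f : E3 → ℝ) (hf : ContDiff ℝ (⊤ : ℕ∞) f) (hharm : ∀ x : E3, lap f x = 0)
    (s δ : ℝ) (hs : 1 ≤ s) (hδ0 : 0 ≤ δ) (hδ3 : δ < 3)
    (hint : Integrable (fun x : E3 => |f x| ^ s * (1 + ‖x‖) ^ (-δ))) :
    ∀ x : E3, f x = 0 := by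
  intro x
  have hc := hf.continuous
  have hpos := integral_bump_pos
  rw [← abs_nonpos_iff]
  refine le_of_forall_pos_le_add fun ε hε => ?_
  rw [zero_add]
  refine le_of_mul_le_mul_right ?_ hpos
  set C := 2 ^ δ * ∫ z, |f z| ^ s * (1 + ‖z‖) ^ (-δ)
  have hbound (r : ℝ) (hr : 1 + ‖x‖ ≤ r) :
      |f x| * ∫ y, bump y ≤ ε * (∫ y, bump y) + ε ^ (1 - s) * (C * r ^ (-(3 - δ))) := by
    have hi : Integrable fun y : E3 => |f (x + r • y)| ^ s * bump y :=
      integrable_mul_bump (Continuous.rpow_const (by fun_prop) fun _ => Or.inr (by linarith))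
    have hbi : Integrable bump := by simpa using integrable_mul_bump continuous_const (g := 1)
    calc |f x| * ∫ y, bump y = |∫ y, f (x + r • y) * bump y| := by
          rw [integral_comp_mul_bump hf hharm, abs_mul, abs_of_pos hpos]
      _ ≤ ∫ y, |f (x + r • y)| * bump y := by
          refine abs_integral_le_integral_abs.trans_eq ?_
          simp only [abs_mul, abs_of_nonneg (bump_nonneg _)]
      _ ≤ ∫ y, (ε * bump y + ε ^ (1 - s) * (|f (x + r • y)| ^ s * bump y)) := by
          refine integral_mono (integrable_mul_bump (by fun_prop))
            ((hbi.const_mul _).add (hi.const_mul _)) fun y => ?_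
          have := mul_le_mul_of_nonneg_right
            (le_add_rpow_mul hs (abs_nonneg (f (x + r • y))) hε) (bump_nonneg y)
          simp only
          linarith
      _ = ε * (∫ y, bump y) + ε ^ (1 - s) * ∫ y, |f (x + r • y)| ^ s * bump y := by
          rw [integral_add (hbi.const_mul _) (hi.const_mul _), integral_const_mul,
            integral_const_mul]
      _ ≤ ε * (∫ y, bump y) + ε ^ (1 - s) * (C * r ^ (-(3 - δ))) := by
          gcongr
          exact integral_abs_rpow_mul_bump_le hc (by linarith) hδ0 hint x hr
  have hlim : Tendsto (fun r : ℝ => ε * (∫ y, bump y) + ε ^ (1 - s) * (C * r ^ (-(3 - δ))))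
      atTop (nhds (ε * ∫ y, bump y)) := by
    simpa using (((tendsto_rpow_neg_atTop (sub_pos.2 hδ3)).const_mul C).const_mul
      (ε ^ (1 - s))).const_add (ε * ∫ y, bump y)
  exact ge_of_tendsto hlim ((eventually_ge_atTop _).mono hbound)
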